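/- arXiv:1401.4927 — 6 statements merged into one kernel-verified Lean document; each statement's English description precedes it below -/
import Mathlib

section
/- (Von Neumann's Minimax Theorem for win-loss matrix games.) For every matrix game u : Fin m → Fin n → ℝ with entries in {0,1}, the supremum over Eloise's mixed strategies μ of the infimum over Abelard's mixed strategies ν of U(μ,ν) equals the infimum over Abelard's mixed strategies ν of the supremum over Eloise's mixed strategies μ of U(μ,ν); moreover both are attained, so max_μ min_ν U(μ,ν) = min_ν max_μ U(μ,ν) = 𝒱(u). -/
open Finset

/-- A mixed strategy over a finite index type: nonnegative weights summing to 1. -/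
def IsMixed {α : Type*} [Fintype α] (μ : α → ℝ) : Prop :=
  (∀ i, 0 ≤ μ i) ∧ ∑ i, μ i = 1

/-- Expected utility for Eloise when she plays mixed strategy `μ` (rows)
and Abelard plays mixed strategy `ν` (columns) in the matrix game `u`. -/
noncomputable def EU {α β : Type*} [Fintype α] [Fintype β]
    (u : α → β → ℝ) (μ : α → ℝ) (ν : β → ℝ) : ℝ :=
  ∑ i, ∑ j, μ i * ν j * u i j

/-- The value of the matrix game `u`:
sup over Eloise's mixed strategies of the inf over Abelard's mixed strategies
of the expected utility. -/
noncomputable def gameValue {α β : Type*} [Fintype α] [Fintype β]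
    (u : α → β → ℝ) : ℝ :=
  ⨆ μ : {μ : α → ℝ // IsMixed μ}, ⨅ ν : {ν : β → ℝ // IsMixed ν}, EU u μ.1 ν.1

section EU

variable {α β : Type*} [Fintype α] [Fintype β]

theorem isLinearMap_EU_left (u : α → β → ℝ) (ν : β → ℝ) : IsLinearMap ℝ fun μ => EU u μ ν where
  map_add μ μ' := by simp only [EU, Pi.add_apply, add_mul, sum_add_distrib]
  map_smul c μ := by simp only [EU, Pi.smul_apply, smul_eq_mul, mul_sum, mul_assoc]

theorem isLinearMap_EU_right (u : α → β → ℝ) (μ : α → ℝ) : IsLinearMap ℝ fun ν => EU u μ ν where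
  map_add ν ν' := by simp only [EU, Pi.add_apply, mul_add, add_mul, sum_add_distrib]
  map_smul c ν := by
    simp only [EU, Pi.smul_apply, smul_eq_mul, mul_sum]
    exact sum_congr rfl fun i _ => sum_congr rfl fun j _ => by ring

theorem IsMixed.le_one {μ : α → ℝ} (hμ : IsMixed μ) (i : α) : μ i ≤ 1 :=
  hμ.2 ▸ single_le_sum (fun k _ => hμ.1 k) (mem_univ i)

theorem abs_EU_le (u : α → β → ℝ) {μ : α → ℝ} {ν : β → ℝ} (hμ : IsMixed μ) (hν : IsMixed ν) :
    |EU u μ ν| ≤ ∑ i, ∑ j, |u i j| := by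
  refine (abs_sum_le_sum_abs _ _).trans (sum_le_sum fun i _ => ?_)
  refine (abs_sum_le_sum_abs _ _).trans (sum_le_sum fun j _ => ?_)
  rw [abs_mul, abs_of_nonneg (mul_nonneg (hμ.1 i) (hν.1 j))]
  exact mul_le_of_le_one_left (abs_nonneg _)
    (mul_le_one₀ (hμ.le_one i) (hν.1 j) (hν.le_one j))

/-- Every finite matrix game has a pair of optimal mixed strategies. -/
theorem exists_saddlePoint_EU [Nonempty α] [Nonempty β] (u : α → β → ℝ) :
    ∃ μ₀ : {μ : α → ℝ // IsMixed μ}, ∃ ν₀ : {ν : β → ℝ // IsMixed ν},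
      ∀ (μ : {μ : α → ℝ // IsMixed μ}) (ν : {ν : β → ℝ // IsMixed ν}),
        EU u μ.1 ν₀.1 ≤ EU u μ₀.1 ν.1 := by
  obtain ⟨ν₀, hν₀, μ₀, hμ₀, h⟩ := Sion.exists_isSaddlePointOn
    (X := stdSimplex ℝ β) (Y := stdSimplex ℝ α) (f := fun ν μ => EU u μ ν)
    Set.Nonempty.of_subtype (convex_stdSimplex ℝ β) (isCompact_stdSimplex ℝ β)
    (fun μ _ => ((isLinearMap_EU_right u μ).mk' _).continuous_of_finiteDimensional
      |>.lowerSemicontinuous.lowerSemicontinuousOn _)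
    (fun μ _ => (((isLinearMap_EU_right u μ).mk' _).convexOn
      (convex_stdSimplex ℝ β)).quasiconvexOn)
    (convex_stdSimplex ℝ α) Set.Nonempty.of_subtype (isCompact_stdSimplex ℝ α)
    (fun ν _ => ((isLinearMap_EU_left u ν).mk' _).continuous_of_finiteDimensional
      |>.upperSemicontinuous.upperSemicontinuousOn _)
    (fun ν _ => (((isLinearMap_EU_left u ν).mk' _).concaveOn
      (convex_stdSimplex ℝ α)).quasiconcaveOn)
  exact ⟨⟨μ₀, hμ₀⟩, ⟨ν₀, hν₀⟩, fun μ ν => h ν.1 ν.2 μ.1 μ.2⟩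

end EU

/-- A bounded function with a saddle point `(a, b)` has equal sup-inf and inf-sup, and these are
attained at `a` and `b` respectively. -/
theorem iSup_iInf_eq_of_saddlePoint {ι κ : Type*} {f : ι → κ → ℝ} {a : ι} {b : κ} {C : ℝ}
    (hC : ∀ x y, |f x y| ≤ C) (h : ∀ x y, f x b ≤ f a y) :
    (⨆ x, ⨅ y, f x y) = f a b ∧ (⨅ y, ⨆ x, f x y) = f a b ∧
      (⨅ y, f a y) = f a b ∧ (⨆ x, f x b) = f a b := by
  have : Nonempty ι := ⟨a⟩
  have : Nonempty κ := ⟨b⟩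
  have below (x : ι) : BddBelow (Set.range (f x)) :=
    ⟨-C, Set.forall_mem_range.2 fun y => (abs_le.1 (hC x y)).1⟩
  have above (y : κ) : BddAbove (Set.range fun x => f x y) :=
    ⟨C, Set.forall_mem_range.2 fun x => (abs_le.1 (hC x y)).2⟩
  have inf_le (x : ι) : (⨅ y, f x y) ≤ f a b := (ciInf_le (below x) b).trans (h x b)
  have le_sup (y : κ) : f a b ≤ ⨆ x, f x y := (h a y).trans (le_ciSup (above y) a)
  have inf_eq : (⨅ y, f a y) = f a b := (inf_le a).antisymm (le_ciInf (h a))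
  have sup_eq : (⨆ x, f x b) = f a b := (ciSup_le fun x => h x b).antisymm (le_sup b)
  refine ⟨(ciSup_le inf_le).antisymm ?_, le_antisymm ?_ (le_ciInf le_sup), inf_eq, sup_eq⟩
  · exact inf_eq.ge.trans (le_ciSup (f := fun x => ⨅ y, f x y)
      ⟨f a b, Set.forall_mem_range.2 inf_le⟩ a)
  · exact (ciInf_le (f := fun y => ⨆ x, f x y)
      ⟨f a b, Set.forall_mem_range.2 le_sup⟩ b).trans sup_eq.le

/-- Von Neumann's Minimax Theorem for win-loss matrix games:
sup-inf equals inf-sup, and both are attained, so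
`max_μ min_ν U(μ,ν) = min_ν max_μ U(μ,ν) = 𝒱(u)`. -/
theorem minimax (m n : ℕ) (hm : 1 ≤ m) (hn : 1 ≤ n)
    (u : Fin m → Fin n → ℝ) (hu : ∀ i j, u i j = 0 ∨ u i j = 1) :
    ((⨆ μ : {μ : Fin m → ℝ // IsMixed μ}, ⨅ ν : {ν : Fin n → ℝ // IsMixed ν}, EU u μ.1 ν.1)
      = ⨅ ν : {ν : Fin n → ℝ // IsMixed ν}, ⨆ μ : {μ : Fin m → ℝ // IsMixed μ}, EU u μ.1 ν.1)
    ∧ (∃ μ₀ : {μ : Fin m → ℝ // IsMixed μ},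
        (⨅ ν : {ν : Fin n → ℝ // IsMixed ν}, EU u μ₀.1 ν.1) = gameValue u)
    ∧ (∃ ν₀ : {ν : Fin n → ℝ // IsMixed ν},
        (⨆ μ : {μ : Fin m → ℝ // IsMixed μ}, EU u μ.1 ν₀.1) = gameValue u) := by
  have : Nonempty (Fin m) := ⟨⟨0, hm⟩⟩
  have : Nonempty (Fin n) := ⟨⟨0, hn⟩⟩
  obtain ⟨μ₀, ν₀, h⟩ := exists_saddlePoint_EU u
  obtain ⟨supInf, infSup, inf_eq, sup_eq⟩ := iSup_iInf_eq_of_saddlePoint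
    (f := fun (μ : {μ : Fin m → ℝ // IsMixed μ}) (ν : {ν : Fin n → ℝ // IsMixed ν}) =>
      EU u μ.1 ν.1) (fun μ ν => abs_EU_le u μ.2 ν.2) h
  exact ⟨supInf.trans infSup.symm, ⟨μ₀, inf_eq.trans supInf.symm⟩, ν₀, sup_eq.trans supInf.symm⟩
end

section
/- (Proposition on the upper bound, part 2.) For every matrix game u : Fin m → Fin n → ℝ with entries in {0,1}, 𝒱(u) ≤ ceil(u). -/
open Finset

lemma EU_nonneg {α β : Type*} [Fintype α] [Fintype β] {u : α → β → ℝ}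
    (hu : ∀ i j, 0 ≤ u i j) {μ : α → ℝ} {ν : β → ℝ} (hμ : IsMixed μ) (hν : IsMixed ν) :
    0 ≤ EU u μ ν :=
  sum_nonneg fun i _ => sum_nonneg fun j _ =>
    mul_nonneg (mul_nonneg (hμ.1 i) (hν.1 j)) (hu i j)

lemma isMixed_uniform (α : Type*) [Fintype α] [Nonempty α] :
    IsMixed fun _ : α => (Fintype.card α : ℝ)⁻¹ :=
  ⟨fun _ => by positivity, by simp⟩

/-- Against the uniform strategy of Abelard, Eloise gets at most the maximal row average. -/
lemma EU_uniform_le {α β : Type*} [Fintype α] [Fintype β] (u : α → β → ℝ)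
    {μ : α → ℝ} (hμ : IsMixed μ) :
    EU u μ (fun _ => (Fintype.card β : ℝ)⁻¹) ≤ (⨆ i, ∑ j, u i j) / Fintype.card β := by
  calc EU u μ (fun _ => (Fintype.card β : ℝ)⁻¹)
      = ∑ i, μ i * ((∑ j, u i j) / Fintype.card β) := by
        simp only [EU, div_eq_inv_mul, mul_sum, mul_assoc]
    _ ≤ ∑ i, μ i * ((⨆ i, ∑ j, u i j) / Fintype.card β) := by
        gcongr with i
        · exact hμ.1 i
        · exact le_ciSup (f := fun i => ∑ j, u i j) (Set.finite_range _).bddAbove i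
    _ = (⨆ i, ∑ j, u i j) / Fintype.card β := by
        rw [← sum_mul, hμ.2, one_mul]

/-- `𝒱(u) ≤ ceil(u)`: the maximal row sum divided by the number of columns
is an upper bound for the value of the game. -/
theorem value_le_ceil (m n : ℕ) (hm : 1 ≤ m) (hn : 1 ≤ n)
    (u : Fin m → Fin n → ℝ) (hu : ∀ i j, u i j = 0 ∨ u i j = 1) :
    gameValue u ≤ (⨆ i : Fin m, ∑ j, u i j) / n := by
  have : NeZero m := ⟨by omega⟩
  have : NeZero n := ⟨by omega⟩
  have hu₀ : ∀ i j, 0 ≤ u i j := fun i j => by rcases hu i j with h | h <;> simp [h]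
  have : Nonempty {μ : Fin m → ℝ // IsMixed μ} := ⟨⟨_, isMixed_uniform _⟩⟩
  refine ciSup_le fun μ => ?_
  have hbdd : BddBelow (Set.range fun ν : {ν : Fin n → ℝ // IsMixed ν} => EU u μ.1 ν.1) :=
    ⟨0, Set.forall_mem_range.2 fun ν => EU_nonneg hu₀ μ.2 ν.2⟩
  simpa using (ciInf_le hbdd ⟨_, isMixed_uniform _⟩).trans (EU_uniform_le u μ.2)
end

section
/- (Proposition on balanced games, part 2.) If a matrix game u : Fin m → Fin n → ℝ with entries in {0,1} is balanced (all rows have equal sum and all columns have equal sum), then the pair (μ̄,ν̄) of uniform strategies is an equilibrium in u. -/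
open Finset

/-- If all row sums of `u` equal `r`, then against a constant strategy `c` every mixed strategy
of the row player yields `c * r`. -/
theorem EU_const_right {α β : Type*} [Fintype α] [Fintype β] {u : α → β → ℝ} {r : ℝ}
    (hr : ∀ i, ∑ j, u i j = r) (c : ℝ) {μ : α → ℝ} (hμ : IsMixed μ) :
    EU u μ (fun _ => c) = c * r := by
  simp_rw [EU, ← mul_sum, hr, ← sum_mul, hμ.2, one_mul]

/-- If all column sums of `u` equal `r`, then against a constant strategy `c` every mixed strategy
of the column player yields `c * r`. -/
theorem EU_const_left {α β : Type*} [Fintype α] [Fintype β] {u : α → β → ℝ} {r : ℝ}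
    (hr : ∀ j, ∑ i, u i j = r) (c : ℝ) {ν : β → ℝ} (hν : IsMixed ν) :
    EU u (fun _ => c) ν = c * r := by
  rw [EU, sum_comm]
  simp_rw [← mul_sum, hr, ← sum_mul, ← mul_sum, hν.2, mul_one]

/-- The uniform distribution is a mixed strategy. -/
theorem isMixed_uniform_s7 {n : ℕ} (hn : 1 ≤ n) : IsMixed (fun _ : Fin n => (1 : ℝ) / n) := by
  have hn' : (n : ℝ) ≠ 0 := by positivity
  exact ⟨fun _ => by positivity, by simp [hn']⟩

/-- For a balanced game, the pair of uniform strategies `(μ̄, ν̄)` is an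
equilibrium: neither player benefits from unilateral deviation. -/
theorem uniform_equilibrium_of_balanced (m n : ℕ) (hm : 1 ≤ m) (hn : 1 ≤ n)
    (u : Fin m → Fin n → ℝ) (hu : ∀ i j, u i j = 0 ∨ u i j = 1)
    (hrow : ∀ i i' : Fin m, ∑ j, u i j = ∑ j, u i' j)
    (hcol : ∀ j j' : Fin n, ∑ i, u i j = ∑ i, u i j') :
    (∀ μ' : Fin m → ℝ, IsMixed μ' →
        EU u μ' (fun _ => (1 : ℝ) / n) ≤ EU u (fun _ => (1 : ℝ) / m) (fun _ => (1 : ℝ) / n))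
    ∧ (∀ ν' : Fin n → ℝ, IsMixed ν' →
        EU u (fun _ => (1 : ℝ) / m) (fun _ => (1 : ℝ) / n) ≤ EU u (fun _ => (1 : ℝ) / m) ν') := by
  have hr (i : Fin m) : ∑ j, u i j = ∑ j, u ⟨0, hm⟩ j := hrow i _
  have hc (j : Fin n) : ∑ i, u i j = ∑ i, u i ⟨0, hn⟩ := hcol j _
  refine ⟨fun μ' hμ' => le_of_eq ?_, fun ν' hν' => le_of_eq ?_⟩
  · rw [EU_const_right hr _ hμ', EU_const_right hr _ (isMixed_uniform_s7 hm)]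
  · rw [EU_const_left hc _ hν', EU_const_left hc _ (isMixed_uniform_s7 hn)]
end

section
/- (Proposition on row submatrices.) For every matrix game u : Fin m → Fin n → ℝ with entries in {0,1} and every nonempty subset S ⊆ Fin m of rows, (min over j : Fin n of ∑ i in S, u i j) / |S| ≤ 𝒱(u). In particular, the maximum of floor(u') over all nonempty row submatrices u' of u is a lower bound for 𝒱(u). -/
open Finset

theorem isMixed_single {α : Type*} [Fintype α] [DecidableEq α] (a : α) :
    IsMixed (Pi.single a (1 : ℝ)) := by
  refine ⟨fun i => ?_, by simp⟩
  by_cases h : i = a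
  · subst h; simp
  · simp [h]

/-- The uniform distribution on a nonempty finite set is a mixed strategy. -/
theorem isMixed_uniformOn {α : Type*} [Fintype α] [DecidableEq α] {S : Finset α}
    (hS : S.Nonempty) : IsMixed (fun i => if i ∈ S then (S.card : ℝ)⁻¹ else 0) := by
  refine ⟨fun i => by positivity, ?_⟩
  have : (S.card : ℝ) ≠ 0 := by exact_mod_cast hS.card_ne_zero
  simp [Finset.sum_ite_mem, this]

theorem EU_eq_sum_mul {α β : Type*} [Fintype α] [Fintype β]
    (u : α → β → ℝ) (μ : α → ℝ) (ν : β → ℝ) :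
    EU u μ ν = ∑ j, ν j * ∑ i, μ i * u i j := by
  simp only [EU, Finset.mul_sum]
  rw [Finset.sum_comm]
  exact Finset.sum_congr rfl fun j _ => Finset.sum_congr rfl fun i _ => by ring

theorem IsMixed.le_sum_mul {α : Type*} [Fintype α] {μ : α → ℝ} (hμ : IsMixed μ)
    {f : α → ℝ} {c : ℝ} (h : ∀ i, c ≤ f i) : c ≤ ∑ i, μ i * f i := by
  calc c = ∑ i, μ i * c := by rw [← Finset.sum_mul, hμ.2, one_mul]
    _ ≤ ∑ i, μ i * f i :=
      Finset.sum_le_sum fun i _ => mul_le_mul_of_nonneg_left (h i) (hμ.1 i)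

theorem IsMixed.sum_mul_le {α : Type*} [Fintype α] {μ : α → ℝ} (hμ : IsMixed μ)
    {f : α → ℝ} {c : ℝ} (h : ∀ i, f i ≤ c) : ∑ i, μ i * f i ≤ c := by
  calc ∑ i, μ i * f i ≤ ∑ i, μ i * c :=
      Finset.sum_le_sum fun i _ => mul_le_mul_of_nonneg_left (h i) (hμ.1 i)
    _ = c := by rw [← Finset.sum_mul, hμ.2, one_mul]

/-- A payoff that a mixed strategy guarantees against every column is a lower bound for the
value of a game with bounded utilities. -/
theorem le_gameValue {α β : Type*} [Fintype α] [Fintype β] [Nonempty β]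
    {u : α → β → ℝ} {a b : ℝ} (ha : ∀ i j, a ≤ u i j) (hb : ∀ i j, u i j ≤ b)
    {μ : α → ℝ} (hμ : IsMixed μ) {c : ℝ} (hc : ∀ j, c ≤ ∑ i, μ i * u i j) :
    c ≤ gameValue u := by
  classical
  let ν₀ : {ν : β → ℝ // IsMixed ν} := ⟨_, isMixed_single (Classical.arbitrary β)⟩
  have : Nonempty {ν : β → ℝ // IsMixed ν} := ⟨ν₀⟩
  have hbdd : BddAbove (Set.range fun μ : {μ : α → ℝ // IsMixed μ} =>
      ⨅ ν : {ν : β → ℝ // IsMixed ν}, EU u μ.1 ν.1) := by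
    refine ⟨b, ?_⟩
    rintro _ ⟨μ', rfl⟩
    have hbelow : BddBelow (Set.range fun ν : {ν : β → ℝ // IsMixed ν} => EU u μ'.1 ν.1) := by
      refine ⟨a, ?_⟩
      rintro _ ⟨ν, rfl⟩
      simp only [EU_eq_sum_mul]
      exact ν.2.le_sum_mul fun j => μ'.2.le_sum_mul fun i => ha i j
    refine (ciInf_le hbelow ν₀).trans ?_
    rw [EU_eq_sum_mul]
    exact ν₀.2.sum_mul_le fun j => μ'.2.sum_mul_le fun i => hb i j
  refine le_trans (le_ciInf fun ν => ?_) (le_ciSup hbdd ⟨μ, hμ⟩)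
  rw [EU_eq_sum_mul]
  exact ν.2.le_sum_mul hc

/-- For every nonempty subset `S` of rows, `floor` of the induced row
submatrix is a lower bound for the value of the game; in particular the
maximum of `floor(u')` over nonempty row submatrices `u'` bounds `𝒱(u)` below. -/
theorem submatrix_floor_le_value (m n : ℕ) (hm : 1 ≤ m) (hn : 1 ≤ n)
    (u : Fin m → Fin n → ℝ) (hu : ∀ i j, u i j = 0 ∨ u i j = 1)
    (S : Finset (Fin m)) (hS : S.Nonempty) :
    (⨅ j : Fin n, ∑ i ∈ S, u i j) / S.card ≤ gameValue u := by
  have : Nonempty (Fin n) := ⟨⟨0, hn⟩⟩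
  refine le_gameValue (a := 0) (b := 1) (fun i j => ?_) (fun i j => ?_)
    (isMixed_uniformOn hS) fun j => ?_
  · rcases hu i j with h | h <;> simp [h]
  · rcases hu i j with h | h <;> simp [h]
  · simp only [ite_mul, zero_mul, Finset.sum_ite_mem, Finset.univ_inter]
    rw [← Finset.mul_sum, div_eq_inv_mul]
    exact mul_le_mul_of_nonneg_left (ciInf_le (Set.finite_range _).bddBelow j) (by positivity)
end

section
/- (The levelling operation strictly decreases collisions.) Let f : α → β with α, β finite and β nonempty. Let v_max be a value of β whose fiber under f has maximal cardinality x, let v_min be a value whose fiber has minimal cardinality y, and suppose x > y + 1. Let k* be an element of the fiber f⁻¹(v_max) and let f' be the function obtained from f by redefining f'(k*) = v_min and f'(k) = f(k) for k ≠ k*. Then the number of colliding ordered pairs of f' is strictly smaller than the number of colliding ordered pairs of f. -/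
/-- The collisions of `g`, split into those avoiding the point `a` and those through `a`. -/
theorem card_collisions_eq_add_two_mul {α β : Type*} [Fintype α] (g : α → β) (a : α) :
    Nat.card {p : α × α // p.1 ≠ p.2 ∧ g p.1 = g p.2} =
      Nat.card {p : α × α // p.1 ≠ a ∧ p.2 ≠ a ∧ p.1 ≠ p.2 ∧ g p.1 = g p.2} +
        2 * Nat.card {k : α // k ≠ a ∧ g k = g a} := by
  classical
  simp only [Nat.card_eq_fintype_card, Fintype.card_subtype]
  set A := Finset.univ.filter
    fun p : α × α => p.1 ≠ a ∧ p.2 ≠ a ∧ p.1 ≠ p.2 ∧ g p.1 = g p.2 with hA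
  set S := Finset.univ.filter fun k : α => k ≠ a ∧ g k = g a with hS
  have hunion : (Finset.univ.filter fun p : α × α => p.1 ≠ p.2 ∧ g p.1 = g p.2) =
      A ∪ (S ×ˢ {a} ∪ {a} ×ˢ S) := by
    ext ⟨i, j⟩
    simp only [hA, hS, Finset.mem_union, Finset.mem_product, Finset.mem_filter,
      Finset.mem_univ, Finset.mem_singleton, true_and]
    grind
  have hST : Disjoint (S ×ˢ {a}) ({a} ×ˢ S) := by
    rw [Finset.disjoint_left]
    rintro ⟨i, j⟩
    simp only [hS, Finset.mem_product, Finset.mem_filter, Finset.mem_singleton]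
    grind
  have hAST : Disjoint A (S ×ˢ {a} ∪ {a} ×ˢ S) := by
    rw [Finset.disjoint_left]
    rintro ⟨i, j⟩
    simp only [hA, Finset.mem_union, Finset.mem_product, Finset.mem_filter,
      Finset.mem_singleton]
    grind
  rw [hunion, Finset.card_union_of_disjoint hAST, Finset.card_union_of_disjoint hST,
    Finset.card_product, Finset.card_product, Finset.card_singleton]
  ring

/-- Removing a point from its fiber lowers the cardinality by one. -/
theorem card_fiber_eq_card_ne_add_one {α β : Type*} [Fintype α] (g : α → β) (a : α) :
    Nat.card {k : α // g k = g a} = Nat.card {k : α // k ≠ a ∧ g k = g a} + 1 := by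
  classical
  simp only [Nat.card_eq_fintype_card, Fintype.card_subtype]
  have herase : (Finset.univ.filter fun k : α => k ≠ a ∧ g k = g a) =
      (Finset.univ.filter fun k : α => g k = g a).erase a := by
    ext k
    simp
  rw [herase, Finset.card_erase_add_one (by simp)]


/-- The levelling operation strictly decreases collisions: if `v_max` has a
fiber of maximal size `x`, `v_min` a fiber of minimal size `y`, `x > y + 1`,
and `f'` is obtained from `f` by redirecting one element `k*` of the maximal
fiber to `v_min`, then `f'` has strictly fewer colliding ordered pairs than
`f`. -/
theorem levelling_decreases_collisions {α β : Type*}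
    [Fintype α] [Fintype β] [DecidableEq α] [Nonempty β]
    (f : α → β) (vmax vmin : β) (x y : ℕ)
    (hx : Nat.card {k : α // f k = vmax} = x)
    (hy : Nat.card {k : α // f k = vmin} = y)
    (hmax : ∀ v : β, Nat.card {k : α // f k = v} ≤ x)
    (hmin : ∀ v : β, y ≤ Nat.card {k : α // f k = v})
    (hxy : y + 1 < x)
    (kstar : α) (hk : f kstar = vmax) :
    Nat.card {p : α × α // p.1 ≠ p.2 ∧
        Function.update f kstar vmin p.1 = Function.update f kstar vmin p.2}
      < Nat.card {p : α × α // p.1 ≠ p.2 ∧ f p.1 = f p.2} := by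
  have hne : vmax ≠ vmin := by
    rintro rfl
    omega
  have hfiber : Nat.card {k : α // k ≠ kstar ∧
      Function.update f kstar vmin k = Function.update f kstar vmin kstar} = y := by
    rw [← hy]
    refine Nat.card_congr (Equiv.subtypeEquivRight fun k => ?_)
    by_cases h : k = kstar
    · subst h
      simp [hk, hne]
    · simp [h]
  have havoid : Nat.card {p : α × α // p.1 ≠ kstar ∧ p.2 ≠ kstar ∧ p.1 ≠ p.2 ∧
        Function.update f kstar vmin p.1 = Function.update f kstar vmin p.2} =
      Nat.card {p : α × α // p.1 ≠ kstar ∧ p.2 ≠ kstar ∧ p.1 ≠ p.2 ∧ f p.1 = f p.2} := by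
    refine Nat.card_congr (Equiv.subtypeEquivRight fun p => ?_)
    refine and_congr_right fun h₁ => and_congr_right fun h₂ => ?_
    rw [Function.update_of_ne h₁, Function.update_of_ne h₂]
  have hcard := card_fiber_eq_card_ne_add_one f kstar
  rw [hk, hx] at hcard
  rw [card_collisions_eq_add_two_mul f kstar,
    card_collisions_eq_add_two_mul (Function.update f kstar vmin) kstar, hfiber, havoid, hk]
  omega
end

section
/- (Degree-at-most-one functions minimize collisions.) Let n ≥ 1 and m ≥ 1, and let g : Fin n → Fin m be any function whose fiber cardinalities differ pairwise by at most 1 (i.e. g has degree at most 1). Then for every function f : Fin n → Fin m, the number of colliding ordered pairs of g is at most the number of colliding ordered pairs of f. -/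
open Finset in
/-- The colliding ordered pairs of `h`, counted fiber by fiber. -/
theorem card_collisions_eq_sum {α β : Type*} [Fintype α] [Fintype β]
    [DecidableEq α] [DecidableEq β] (h : α → β) :
    (Nat.card {p : α × α // p.1 ≠ p.2 ∧ h p.1 = h p.2} : ℤ) =
      ∑ v, ((Nat.card {k // h k = v} : ℤ) * Nat.card {k // h k = v} - Nat.card {k // h k = v}) := by
  simp only [Nat.card_eq_fintype_card, Fintype.card_subtype]
  rw [card_eq_sum_card_fiberwise (f := fun p => h p.1) (t := univ) (fun _ _ => by simp)]
  push_cast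
  refine sum_congr rfl fun v _ => ?_
  have hfiber : ({p ∈ ({p | p.1 ≠ p.2 ∧ h p.1 = h p.2} : Finset (α × α)) | h p.1 = v}) =
      ({k | h k = v} : Finset α).offDiag := by
    ext p
    simp only [mem_filter, mem_univ, true_and, mem_offDiag]
    grind
  rw [hfiber, offDiag_card, Nat.cast_sub (Nat.le_mul_self _), Nat.cast_mul]

/-- The fiber cardinalities add up to the cardinality of the domain. -/
theorem sum_card_fiber {α β : Type*} [Fintype α] [Fintype β] (h : α → β) :
    ∑ v, (Nat.card {k // h k = v} : ℤ) = Nat.card α := by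
  rw [← Nat.card_congr (Equiv.sigmaFiberEquiv h), Nat.card_sigma]
  push_cast
  rfl

/-- Among integer families with a given sum, one with values in `{q, q + 1}` minimizes
`∑ v, (x v * x v - x v)`. -/
theorem sum_mul_self_sub_le_of_balanced {β : Type*} [Fintype β] (q : ℤ) (a b : β → ℤ)
    (hb : ∀ v, q ≤ b v ∧ b v ≤ q + 1) (hab : ∑ v, a v = ∑ v, b v) :
    ∑ v, (b v * b v - b v) ≤ ∑ v, (a v * a v - a v) := by
  have hterm (v : β) : b v * b v - b v - 2 * q * b v ≤ a v * a v - a v - 2 * q * a v := by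
    have hb0 : (b v - q) * (b v - q - 1) ≤ 0 :=
      mul_nonpos_of_nonneg_of_nonpos (by linarith [hb v]) (by linarith [hb v])
    have ha0 : 0 ≤ (a v - q) * (a v - q - 1) := by
      rcases le_or_gt (a v) q with h | h
      · exact mul_nonneg_of_nonpos_of_nonpos (by omega) (by omega)
      · exact mul_nonneg (by omega) (by omega)
    linarith
  have hsum := Finset.sum_le_sum fun v (_ : v ∈ Finset.univ) => hterm v
  rw [Finset.sum_sub_distrib, Finset.sum_sub_distrib (g := fun v => 2 * q * a v),
    ← Finset.mul_sum, ← Finset.mul_sum, hab] at hsum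
  linarith

/-- Degree-at-most-one functions minimize collisions: if the fiber sizes of
`g : Fin n → Fin m` pairwise differ by at most 1, then `g` has no more
colliding ordered pairs than any function `f : Fin n → Fin m`. -/
theorem degree_le_one_minimizes_collisions (n m : ℕ) (hn : 1 ≤ n) (hm : 1 ≤ m)
    (g : Fin n → Fin m)
    (hg : ∀ v w : Fin m,
        Nat.card {k : Fin n // g k = v} ≤ Nat.card {k : Fin n // g k = w} + 1)
    (f : Fin n → Fin m) :
    Nat.card {p : Fin n × Fin n // p.1 ≠ p.2 ∧ g p.1 = g p.2}
      ≤ Nat.card {p : Fin n × Fin n // p.1 ≠ p.2 ∧ f p.1 = f p.2} := by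
  have : Nonempty (Fin m) := ⟨⟨0, hm⟩⟩
  obtain ⟨w, hw⟩ := Finite.exists_min fun v => Nat.card {k : Fin n // g k = v}
  zify
  rw [card_collisions_eq_sum, card_collisions_eq_sum]
  refine sum_mul_self_sub_le_of_balanced (Nat.card {k : Fin n // g k = w}) _ _
    (fun v => ⟨by exact_mod_cast hw v, by exact_mod_cast hg v w⟩) ?_
  rw [sum_card_fiber, sum_card_fiber]
end
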